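/- arXiv:2104.10286 — 2 statements merged into one kernel-verified Lean document; each statement's English description precedes it below -/
import Mathlib

section
/- Let Σ be an alphabet, w ∈ ℕ⁺, τ = (R₁,…,Rᵣ) a relational vocabulary with arities a₁,…,aᵣ, and p ∈ ℕ. The (r+1+p)-ary relation R(Σ,w,τ,p) = {(D₀, D₁, …, Dᵣ, v₁, …, v_p) : (D₀,D₁,…,Dᵣ) ∈ D(Σ,w,τ) and v₁,…,v_p ∈ L(D₀)} is regular. In particular, for p = 0 the relation D(Σ,w,τ) of all (Σ,w,τ)-structural tuples is regular. -/
open FirstOrder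

/-- A language (set of strings) is regular if it is recognized by a
deterministic finite automaton with finitely many states. -/
def LangRegular {β : Type} (L : Set (List β)) : Prop :=
  Language.IsRegular (L : Language β)

/-- A `(Σ,w)`-layer: left/right frontiers contained in `{0,…,w−1}`, a set of
transitions labelled by symbols of `Σ` or the padding symbol (`none`), sets of
initial and final states, and two boolean flags. -/
structure Layer (σ : Type) (w : ℕ) where
  left : Set (Fin w)
  right : Set (Fin w)
  trans : Set (Fin w × Option σ × Fin w)
  initial : Set (Fin w)
  final : Set (Fin w)
  ini : Bool
  fin : Bool
  trans_mem : ∀ t ∈ trans, t.1 ∈ left ∧ t.2.2 ∈ right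
  initial_sub : initial ⊆ left
  final_sub : final ⊆ right
  initial_empty : ini = false → initial = ∅
  final_empty : fin = false → final = ∅

instance {σ : Type} {w : ℕ} : Inhabited (Layer σ w) :=
  ⟨{ left := ∅, right := ∅, trans := ∅, initial := ∅, final := ∅,
     ini := false, fin := false,
     trans_mem := by simp, initial_sub := by simp, final_sub := by simp,
     initial_empty := fun _ => rfl, final_empty := fun _ => rfl }⟩

/-- A string of layers is a `(Σ,w)`-ODD: it is non-empty, consecutive frontiers
match, the initial flag is set exactly on the first layer, and the final flag is
set exactly on the last layer. -/
def IsODD {σ : Type} {w : ℕ} (D : List (Layer σ w)) : Prop :=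
  D ≠ [] ∧
  (∀ i : ℕ, (h : i + 1 < D.length) →
    (D[i + 1]'h).left = (D[i]'(by omega)).right) ∧
  (∀ i : ℕ, (h : i < D.length) →
    ((D[i]'h).ini = true ↔ i = 0) ∧ ((D[i]'h).fin = true ↔ i = D.length - 1))

/-- Acceptance of a (non-empty) string `s` of length at most `|D|` by the ODD `D`:
there is a sequence of compatible transitions, reading the symbols of `s` followed
by padding symbols, from an initial state of the first layer to a final state of
the last layer. -/
def OddAccepts {σ : Type} {w : ℕ} (D : List (Layer σ w)) (s : List σ) : Prop :=
  s ≠ [] ∧ s.length ≤ D.length ∧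
  ∃ st : ℕ → Fin w,
    (∀ i : ℕ, (h : i < D.length) → (st i, s[i]?, st (i + 1)) ∈ (D[i]'h).trans) ∧
    ∀ h : 0 < D.length,
      st 0 ∈ (D[0]'h).initial ∧ st D.length ∈ (D[D.length - 1]'(by omega)).final

/-- The language of an ODD. -/
def OddLang {σ : Type} {w : ℕ} (D : List (Layer σ w)) : Set (List σ) :=
  { s | OddAccepts D s }

/-- Convolution (tensor product) of a family of strings over (possibly different)
alphabets: the string of length `max_i |u_i|` whose `j`-th symbol has `i`-th
component the `j`-th symbol of `u_i` if `j < |u_i|`, and the padding symbol `none`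
otherwise. -/
def convD {a : ℕ} {α : Fin a → Type} (us : ∀ i, List (α i)) :
    List (∀ i, Option (α i)) :=
  List.ofFn fun j : Fin (Finset.univ.sup fun i => (us i).length) =>
    fun i => (us i)[(j : ℕ)]?

/-- A relation of tuples of strings is regular if its associated language, the set
of convolutions of its tuples, is a regular language. -/
def RegularRelD {a : ℕ} {α : Fin a → Type} (R : Set (∀ i, List (α i))) : Prop :=
  LangRegular { x | ∃ us ∈ R, convD us = x }

/-- Convolution of a pair of strings over two alphabets. -/
def conv2 {α β : Type} (u : List α) (v : List β) : List (Option α × Option β) :=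
  List.ofFn fun j : Fin (max u.length v.length) => (u[(j : ℕ)]?, v[(j : ℕ)]?)

/-- A binary relation of strings is regular if its associated language is regular. -/
def Regular2 {α β : Type} (R : Set (List α × List β)) : Prop :=
  LangRegular { x | ∃ p ∈ R, conv2 p.1 p.2 = x }

/-- Convolution of an `(a+1)`-tuple of strings `(u, v₁, …, vₐ)` where `u` is over
the alphabet `α` and the `v`s over the alphabet `β`. -/
def conv1a {α β : Type} {a : ℕ} (u : List α) (vs : Fin a → List β) :
    List (Option α × (Fin a → Option β)) :=
  List.ofFn fun j : Fin (max u.length (Finset.univ.sup fun i => (vs i).length)) =>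
    (u[(j : ℕ)]?, fun i => (vs i)[(j : ℕ)]?)

/-- An `(a+1)`-ary relation whose first coordinate is a string over `α` and whose
remaining `a` coordinates are strings over `β` is regular if its associated
language of convolutions is regular. -/
def Regular1a {α β : Type} {a : ℕ} (R : Set (List α × (Fin a → List β))) : Prop :=
  LangRegular { x | ∃ p ∈ R, conv1a p.1 p.2 = x }

/-- The `a`-fold tensor product `L^{⊗a}` of a language `L`. -/
def tensorLang {σ : Type} {a : ℕ} (L : Set (List σ)) :
    Set (List (Fin a → Option σ)) :=
  { x | ∃ us : Fin a → List σ, (∀ i, us i ∈ L) ∧ convD us = x }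

/-- The purely relational first-order vocabulary with `r` relation symbols of
arities `ar 0, …, ar (r-1)`. -/
def vocLang (r : ℕ) (ar : Fin r → ℕ) : FirstOrder.Language :=
  { Functions := fun _ => Empty, Relations := fun n => { i : Fin r // ar i = n } }

/-- A tuple `(D₀, D₁, …, Dᵣ)` is `(Σ,w,τ)`-structural: all ODDs have a common
length, `D₀` is over `Σ`, `Dᵢ` is over `Σ^{⊗aᵢ}` (with padding components), and
`L(Dᵢ) ⊆ L(D₀)^{⊗aᵢ}`. -/
def IsStructural {σ : Type} {w r : ℕ} {ar : Fin r → ℕ}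
    (D₀ : List (Layer σ w))
    (Ds : ∀ i : Fin r, List (Layer (Fin (ar i) → Option σ) w)) : Prop :=
  IsODD D₀ ∧
  ∀ i : Fin r, IsODD (Ds i) ∧ (Ds i).length = D₀.length ∧
    OddLang (Ds i) ⊆ tensorLang (OddLang D₀)

/-- The `τ`-structure derived from a structural tuple: its domain is `L(D₀)` and
the `i`-th relation holds of `(u₁,…,u_{aᵢ})` iff `u₁⊗⋯⊗u_{aᵢ} ∈ L(Dᵢ)`. -/
def derivedStr {σ : Type} {w r : ℕ} {ar : Fin r → ℕ}
    (D₀ : List (Layer σ w))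
    (Ds : ∀ i : Fin r, List (Layer (Fin (ar i) → Option σ) w)) :
    (vocLang r ar).Structure { s : List σ // s ∈ OddLang D₀ } where
  funMap := fun f _ => f.elim
  RelMap := fun {n} Rl x =>
    match Rl with
    | ⟨i, h⟩ =>
      convD (fun m : Fin (ar i) => (x (Fin.cast h m)).val) ∈ OddLang (Ds i)

/-- The type of `(r+1)`-tuples of ODDs `(D₀, D₁, …, Dᵣ)`. -/
def StructTuple (σ : Type) (w r : ℕ) (ar : Fin r → ℕ) : Type :=
  List (Layer σ w) × ((i : Fin r) → List (Layer (Fin (ar i) → Option σ) w))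

/-- Convolution of an `(r+1)`-tuple of ODDs. -/
def convTuple {σ : Type} {w r : ℕ} {ar : Fin r → ℕ} (q : StructTuple σ w r ar) :
    List (Option (Layer σ w) ×
      ((i : Fin r) → Option (Layer (Fin (ar i) → Option σ) w))) :=
  List.ofFn fun j : Fin (max q.1.length (Finset.univ.sup fun i => (q.2 i).length)) =>
    (q.1[(j : ℕ)]?, fun i => (q.2 i)[(j : ℕ)]?)

/-- A set of `(r+1)`-tuples of ODDs is regular if its associated language of
convolutions is regular. -/
def RegularTuple {σ : Type} {w r : ℕ} {ar : Fin r → ℕ}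
    (R : Set (StructTuple σ w r ar)) : Prop :=
  LangRegular { x | ∃ q ∈ R, convTuple q = x }

/-- The type of `(r+1+p)`-tuples `(D₀, D₁, …, Dᵣ, v₁, …, v_p)`. -/
def StructTupleV (σ : Type) (w r : ℕ) (ar : Fin r → ℕ) (p : ℕ) : Type :=
  StructTuple σ w r ar × (Fin p → List σ)

/-- Convolution of an `(r+1+p)`-tuple `(D₀, D₁, …, Dᵣ, v₁, …, v_p)`. -/
def convStruct {σ : Type} {w r : ℕ} {ar : Fin r → ℕ} {p : ℕ}
    (q : StructTupleV σ w r ar p) :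
    List ((Option (Layer σ w) ×
        ((i : Fin r) → Option (Layer (Fin (ar i) → Option σ) w))) ×
      (Fin p → Option σ)) :=
  List.ofFn fun j : Fin (max (max q.1.1.length
      (Finset.univ.sup fun i => (q.1.2 i).length))
      (Finset.univ.sup fun t => (q.2 t).length)) =>
    ((q.1.1[(j : ℕ)]?, fun i => (q.1.2 i)[(j : ℕ)]?), fun t => (q.2 t)[(j : ℕ)]?)

/-- A set of `(r+1+p)`-tuples is regular if its associated language of
convolutions is regular. -/
def RegularStruct {σ : Type} {w r : ℕ} {ar : Fin r → ℕ} {p : ℕ}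
    (R : Set (StructTupleV σ w r ar p)) : Prop :=
  LangRegular { x | ∃ q ∈ R, convStruct q = x }

namespace LangRegular

variable {β γ : Type}

theorem compl {P : List β → Prop} (h : LangRegular {x | P x}) : LangRegular {x | ¬ P x} :=
  Language.IsRegular.compl h

theorem and {P Q : List β → Prop} (hP : LangRegular {x | P x}) (hQ : LangRegular {x | Q x}) :
    LangRegular {x | P x ∧ Q x} :=
  Language.IsRegular.inf hP hQ

theorem imp {P Q : List β → Prop} (hP : LangRegular {x | P x}) (hQ : LangRegular {x | Q x}) :
    LangRegular {x | P x → Q x} := by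
  simpa using (hP.and hQ.compl).compl

theorem univ : LangRegular {_x : List β | True} :=
  ⟨Unit, inferInstance, ⟨fun _ _ => (), (), Set.univ⟩, by ext x; exact Iff.rfl⟩

theorem forall_finite {ι : Type} [Finite ι] {P : ι → List β → Prop}
    (h : ∀ i, LangRegular {x | P i x}) : LangRegular {x | ∀ i, P i x} := by
  have key (s : Finset ι) : LangRegular {x | ∀ i ∈ s, P i x} := by
    classical
    induction s using Finset.induction_on with
    | empty => simpa using univ
    | insert a s _ ih => simpa using (h a).and ih
  have := Fintype.ofFinite ι
  simpa using key Finset.univ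

theorem comap {P : List γ → Prop} (h : LangRegular {x | P x}) (f : β → γ) :
    LangRegular {x | P (x.map f)} := by
  obtain ⟨s, _, M, hM⟩ := h
  exact ⟨s, inferInstance, M.comap f, by rw [DFA.accepts_comap, hM]; rfl⟩

theorem exists_map {P : List γ → Prop} (h : LangRegular {x | P x}) (f : γ → β) :
    LangRegular {x | ∃ z, z.map f = x ∧ P z} := by
  classical
  obtain ⟨s, _, M, hM⟩ := h
  let N : NFA β s := ⟨fun q b => {q' | ∃ c, f c = b ∧ M.step q c = q'}, {M.start}, M.accept⟩
  have key (x : List β) (S : Set s) (q' : s) :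
      q' ∈ N.evalFrom S x ↔ ∃ q ∈ S, ∃ z, z.map f = x ∧ M.evalFrom q z = q' := by
    induction x generalizing S with
    | nil => simp
    | cons b x ih =>
      rw [NFA.evalFrom_cons, ih]
      simp only [NFA.mem_stepSet, N, Set.mem_ofPred_eq, List.map_eq_cons_iff]
      constructor
      · rintro ⟨_, ⟨q, hq, c, rfl, rfl⟩, z, rfl, rfl⟩
        exact ⟨q, hq, c :: z, ⟨c, z, rfl, rfl, rfl⟩, rfl⟩
      · rintro ⟨q, hq, _, ⟨c, z, rfl, rfl, rfl⟩, rfl⟩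
        exact ⟨_, ⟨q, hq, c, rfl, rfl⟩, z, rfl, rfl⟩
  refine ⟨Set s, inferInstance, N.toDFA, ?_⟩
  rw [NFA.toDFA_correct]
  ext x
  have hP (z : List γ) : M.eval z ∈ M.accept ↔ P z := by
    rw [← DFA.mem_accepts, hM]; rfl
  rw [NFA.mem_accepts]
  simp only [key]
  constructor
  · rintro ⟨_, hS, _, rfl, z, rfl, rfl⟩
    exact ⟨z, rfl, (hP z).1 hS⟩
  · rintro ⟨z, rfl, hz⟩
    exact ⟨_, (hP z).2 hz, _, rfl, z, rfl, rfl⟩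

theorem forall_map {P : List γ → Prop} (h : LangRegular {x | P x}) (f : γ → β) :
    LangRegular {x | ∀ z, z.map f = x → P z} := by
  simpa using (h.compl.exists_map f).compl

/-- A language given by a condition on the first symbol and a condition on each symbol together
with its successor is regular. -/
theorem local_of_finite [Finite β] (A : Option β → Prop) (R : β → Option β → Prop) :
    LangRegular {x | A x[0]? ∧ ∀ i, (h : i < x.length) → R x[i] x[i + 1]?} := by
  classical
  have := Fintype.ofFinite β
  let M : DFA β (Option (Option β)) :=
    { step := fun q c => match q with
        | none => none
        | some none => if A (some c) then some (some c) else none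
        | some (some b) => if R b (some c) then some (some c) else none
      start := some none
      accept := {q | match q with
        | none => False
        | some none => A none
        | some (some b) => R b none} }
  have dead (x : List β) : M.evalFrom none x = none := by
    induction x with
    | nil => rfl
    | cons c x ih => exact ih
  have key (x : List β) (b : β) : M.evalFrom (some (some b)) x ∈ M.accept ↔
      ∀ i, (h : i < (b :: x).length) → R (b :: x)[i] (b :: x)[i + 1]? := by
    induction x generalizing b with
    | nil => simp [M]
    | cons c x ih =>
      have split : (∀ i, (h : i < (b :: c :: x).length) →
            R (b :: c :: x)[i] (b :: c :: x)[i + 1]?) ↔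
          R b (some c) ∧ ∀ i, (h : i < (c :: x).length) → R (c :: x)[i] (c :: x)[i + 1]? := by
        refine ⟨fun H => ⟨H 0 (by simp), fun i h => H (i + 1) (by simpa using h)⟩, ?_⟩
        rintro ⟨h0, H⟩ (_ | i) h
        · exact h0
        · exact H i (by simpa using h)
      rw [DFA.evalFrom_cons, split]
      by_cases hR : R b (some c)
      · have : M.step (some (some b)) c = some (some c) := by simp [M, hR]
        rw [this, ih]
        simp only [hR, true_and]
      · have : M.step (some (some b)) c = none := by simp [M, hR]
        rw [this, dead]
        simp [hR, M]
  refine ⟨_, inferInstance, M, ?_⟩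
  ext x
  rw [DFA.mem_accepts]
  change _ ↔ _ ∧ _
  cases x with
  | nil => simp [M]
  | cons c x =>
    rw [DFA.eval, DFA.evalFrom_cons]
    by_cases hA : A (some c)
    · have : M.step M.start c = some (some c) := by simp [M, hA]
      rw [this, key]
      simp only [List.getElem?_cons_zero, hA, true_and]
    · have : M.step M.start c = none := by simp [M, hA]
      rw [this, dead]
      simp [hA, M]

end LangRegular

instance Layer.instFinite {σ : Type} [Finite σ] {w : ℕ} : Finite (Layer σ w) :=
  Finite.of_injective
    (fun l : Layer σ w => (l.left, l.right, l.trans, l.initial, l.final, l.ini, l.fin)) <| by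
    intro l l' h
    cases l
    cases l'
    simpa using h

/-- `y` consists of the symbols of `s` followed by padding symbols. -/
def IsPadding {α : Type} (y : List (Option α)) (s : List α) : Prop :=
  ∀ i : ℕ, s[i]? = y[i]?.join

namespace IsPadding

variable {α : Type} {y : List (Option α)} {s : List α}

theorem length_le (h : IsPadding y s) : s.length ≤ y.length := by
  have := h y.length
  simpa using this

theorem exists_of_getElem (y : List (Option α))
    (h : ∀ i, (hi : i + 1 < y.length) → y[i] = none → y[i + 1] = none) :
    ∃ s, IsPadding y s := by
  induction y with
  | nil => exact ⟨[], fun i => by simp⟩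
  | cons c y ih =>
    obtain ⟨s, hs⟩ := ih fun i hi => h (i + 1) (by simpa using hi)
    cases c with
    | some a =>
      refine ⟨a :: s, ?_⟩
      rintro (_ | i)
      · simp
      · simpa using hs i
    | none =>
      have hs0 : s = [] := by
        cases y with
        | nil => simpa using hs.length_le
        | cons d y =>
          have hd : d = none := h 0 (by simp) rfl
          have := hs 0
          simpa [hd] using this
      subst hs0
      refine ⟨[], ?_⟩
      rintro (_ | i)
      · simp
      · simpa using hs i

theorem getElem_succ_eq_none (h : IsPadding y s) {i : ℕ} (hi : i + 1 < y.length)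
    (hn : y[i] = none) : y[i + 1] = none := by
  have h1 := h i
  have h2 := h (i + 1)
  rw [List.getElem?_eq_getElem (l := y) (by omega), hn] at h1
  rw [List.getElem?_eq_getElem (l := y) hi] at h2
  have : s.length ≤ i := by simpa using h1
  rw [List.getElem?_eq_none (by omega)] at h2
  simpa using h2.symm

end IsPadding

/-- `y` is a string accepted by `D`, followed by padding symbols. -/
def PadAccepts {σ : Type} {w : ℕ} (D : List (Layer σ w)) (y : List (Option σ)) : Prop :=
  ∃ s, OddAccepts D s ∧ IsPadding y s

theorem langRegular_isODD {β σ : Type} [Finite σ] {w : ℕ} (f : β → Layer σ w) :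
    LangRegular {x : List β | IsODD (x.map f)} := by
  have h := (LangRegular.local_of_finite (β := Layer σ w)
    (fun c => ∃ l, c = some l ∧ l.ini = true)
    (fun l c => match c with
      | none => l.fin = true
      | some l' => l.fin = false ∧ l'.left = l.right ∧ l'.ini = false)).comap f
  convert h using 4 with x
  generalize x.map f = D
  constructor
  · rintro ⟨hne, hfr, hfl⟩
    have hpos : 0 < D.length := List.length_pos_iff.2 hne
    refine ⟨⟨D[0], List.getElem?_eq_getElem hpos, (hfl 0 hpos).1.2 rfl⟩, fun i hi => ?_⟩
    by_cases hi' : i + 1 < D.length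
    · rw [List.getElem?_eq_getElem hi']
      refine ⟨?_, hfr i hi', ?_⟩
      · have := (hfl i hi).2
        rw [← Bool.not_eq_true, this]
        omega
      · have := (hfl (i + 1) hi').1
        rw [← Bool.not_eq_true, this]
        omega
    · rw [List.getElem?_eq_none (by omega)]
      exact (hfl i hi).2.2 (by omega)
  · rintro ⟨⟨l, hl, hini⟩, H⟩
    obtain ⟨hpos, hl⟩ := List.getElem?_eq_some_iff.1 hl
    have H' (i : ℕ) (hi : i + 1 < D.length) :
        D[i].fin = false ∧ D[i + 1].left = D[i].right ∧ D[i + 1].ini = false := by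
      have := H i (by omega)
      rwa [List.getElem?_eq_getElem hi] at this
    refine ⟨List.length_pos_iff.1 hpos, fun i hi => (H' i hi).2.1, fun i hi => ⟨?_, ?_⟩⟩
    · cases i with
      | zero => simpa [hl] using hini
      | succ i => simpa using (H' i hi).2.2
    · by_cases hi' : i + 1 < D.length
      · simp only [(H' i hi').1, Bool.false_eq_true, false_iff]
        omega
      · have := H i hi
        rw [List.getElem?_eq_none (by omega)] at this
        simp only [this, true_iff]
        omega

theorem langRegular_padAccepts {β σ : Type} [Finite σ] {w : ℕ} (f : β → Layer σ w)
    (g : β → Option σ) : LangRegular {x : List β | PadAccepts (x.map f) (x.map g)} := by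
  have h := ((LangRegular.local_of_finite (β := (Layer σ w × Option σ) × Fin w × Fin w)
    (fun c => ∃ b, c = some b ∧ b.2.1 ∈ b.1.1.initial ∧ b.1.2 ≠ none)
    (fun b c => (b.2.1, b.1.2, b.2.2) ∈ b.1.1.trans ∧ match c with
      | none => b.2.2 ∈ b.1.1.final
      | some b' => b.2.2 = b'.2.1 ∧ (b.1.2 = none → b'.1.2 = none))).exists_map
        Prod.fst).comap fun c => (f c, g c)
  convert h using 4 with x
  constructor
  · rintro ⟨s, ⟨hne, hlen, st, htr, hst⟩, hpad⟩
    rw [List.length_map] at hlen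
    have hget (i : ℕ) (hi : i < x.length) : s[i]? = g x[i] := by
      have := hpad i
      simpa [hi] using this
    have hpos : 0 < x.length := (List.length_pos_iff.2 hne).trans_le hlen
    refine ⟨x.mapIdx fun i c => ((f c, g c), st i, st (i + 1)), ?_, ?_, ?_⟩
    · apply List.ext_getElem <;> simp
    · refine ⟨((f x[0], g x[0]), st 0, st 1), by simp [hpos], ?_, ?_⟩
      · have := (hst (by simpa using hpos)).1
        rw [List.getElem_map] at this
        simpa using this
      · rw [← hget 0 hpos]
        simpa using hne
    · intro i hi
      have hi : i < x.length := by simpa using hi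
      refine ⟨?_, ?_⟩
      · have := htr i (by simpa using hi)
        rw [hget i hi] at this
        simpa using this
      by_cases hi' : i + 1 < x.length
      · rw [List.getElem?_eq_getElem (by simpa using hi')]
        simp only [List.getElem_mapIdx, true_and]
        intro hn
        have := hpad.getElem_succ_eq_none (i := i) (by simpa using hi')
        simpa [hn] using this
      · rw [List.getElem?_eq_none (by simp; omega)]
        have := (hst (by simpa using hpos)).2
        have hx : x.length - 1 = i := by omega
        have hx' : x.length = i + 1 := by omega
        simpa [hx, hx'] using this
  · rintro ⟨z, hz, ⟨b, hb, hini, hsome⟩, H⟩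
    have hlen : z.length = x.length := by simpa using congrArg List.length hz
    obtain ⟨hpos, hb⟩ := List.getElem?_eq_some_iff.1 hb
    have hzx (i : ℕ) (hi : i < x.length) : z[i].1 = (f x[i], g x[i]) := by
      have := congrArg (fun l => l[i]?) hz
      simpa [hi, hlen] using this
    have H' (i : ℕ) (hi : i + 1 < z.length) :
        z[i].2.2 = z[i + 1].2.1 ∧ (z[i].1.2 = none → z[i + 1].1.2 = none) := by
      have := (H i (by omega)).2
      rwa [List.getElem?_eq_getElem hi] at this
    obtain ⟨s, hs⟩ := IsPadding.exists_of_getElem (x.map g) fun i hi => by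
      have hi : i + 1 < x.length := by simpa using hi
      have := (H' i (by omega)).2
      rw [hzx i (by omega), hzx (i + 1) hi] at this
      simpa using this
    have hget (i : ℕ) (hi : i < x.length) : s[i]? = g x[i] := by
      have := hs i
      simpa [hi] using this
    have hb0 : z[0].1 = (f x[0], g x[0]) := hzx 0 (by omega)
    rw [hb] at hb0
    let st (i : ℕ) : Fin w := if h : i < z.length then z[i].2.1 else z[z.length - 1].2.2
    refine ⟨s, ⟨?_, by simpa using hs.length_le, st, fun i hi => ?_, fun _ => ⟨?_, ?_⟩⟩, hs⟩
    · rintro rfl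
      have := hget 0 (by omega)
      rw [hb0] at hsome
      exact hsome (by simpa using this.symm)
    · have hi : i < x.length := by simpa using hi
      have hi' : i < z.length := by omega
      have hst : st (i + 1) = z[i].2.2 := by
        by_cases h1 : i + 1 < z.length
        · simp only [st, h1, dite_true, (H' i h1).1]
        · have : z.length - 1 = i := by omega
          simp [st, h1, this]
      have := (H i hi').1
      rw [hzx i hi] at this
      rw [hget i hi, hst, List.getElem_map]
      simpa only [st, hi', dite_true] using this
    · rw [hb0] at hini
      simpa only [st, hpos, dite_true, hb, List.getElem_map] using hini
    · have hl : z.length - 1 < z.length := by omega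
      have := (H _ hl).2
      rw [List.getElem?_eq_none (by omega)] at this
      rw [hzx _ (by omega)] at this
      simpa [st, hlen] using this

theorem IsPadding.bind_map {α γ : Type} {y : List (Option α)} {s : List α} (h : IsPadding y s)
    (f : α → Option γ) (u : List γ) :
    IsPadding (y.map (·.bind f)) u ↔ ∀ i : ℕ, u[i]? = s[i]?.bind f := by
  refine forall_congr' fun i => ?_
  rw [h i, List.getElem?_map]
  cases y[i]? <;> simp

theorem IsPadding.mem_iff {α : Type} {y : List (Option α)} {s : List α} (h : IsPadding y s)
    (a : α) : some a ∈ y ↔ a ∈ s := by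
  simp only [List.mem_iff_getElem?, h _, Option.join_eq_some_iff]

theorem getElem?_convD {a : ℕ} {α : Fin a → Type} (us : ∀ i, List (α i)) (j : ℕ) :
    (convD us)[j]? =
      if j < Finset.univ.sup (fun i => (us i).length) then some fun i => (us i)[j]? else none := by
  simp [convD, List.getElem?_ofFn]

/-- Membership in a tensor power, expressed on a padded string. -/
theorem IsPadding.mem_tensorLang_iff {σ : Type} {w a : ℕ} {D : List (Layer σ w)}
    {y : List (Option (Fin a → Option σ))} {s : List (Fin a → Option σ)} (h : IsPadding y s) :
    s ∈ tensorLang (OddLang D) ↔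
      (∀ m, PadAccepts D (y.map (·.bind (· m)))) ∧ ∀ v, some v ∈ y → ∃ m, v m ≠ none := by
  simp only [h.mem_iff]
  constructor
  · rintro ⟨us, hus, rfl⟩
    refine ⟨fun m => ⟨us m, hus m, (h.bind_map _ _).2 fun i => ?_⟩, fun v hv => ?_⟩
    · rw [getElem?_convD]
      split_ifs with hi
      · rfl
      · have : (us m).length ≤ _ := Finset.le_sup (f := fun i => (us i).length) (Finset.mem_univ m)
        simpa using this.trans (not_lt.1 hi)
    · obtain ⟨i, hi⟩ := List.mem_iff_getElem?.1 hv
      rw [getElem?_convD] at hi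
      split_ifs at hi with hlt
      obtain ⟨m, -, hm⟩ := Finset.lt_sup_iff.1 hlt
      refine ⟨m, ?_⟩
      rw [← Option.some.inj hi]
      simpa using hm
  · rintro ⟨hacc, hne⟩
    choose us hus hpad using hacc
    have hget (m : Fin a) (i : ℕ) := (h.bind_map _ _).1 (hpad m) i
    refine ⟨us, hus, List.ext_getElem? fun i => ?_⟩
    rw [getElem?_convD]
    by_cases hi : i < s.length
    · have hs := List.getElem?_eq_getElem hi
      have hlt : i < Finset.univ.sup fun m => (us m).length := by
        obtain ⟨m, hm⟩ := hne _ (List.getElem_mem hi)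
        refine Finset.lt_sup_iff.2 ⟨m, Finset.mem_univ m, ?_⟩
        by_contra hle
        have := hget m i
        rw [hs, List.getElem?_eq_none (by omega)] at this
        exact hm this.symm
      rw [if_pos hlt, hs]
      simp only [hget, hs, Option.bind_some]
    · have hs : s[i]? = none := List.getElem?_eq_none (by omega)
      have hlt : ¬ i < Finset.univ.sup fun m => (us m).length := by
        intro hlt
        obtain ⟨m, -, hm⟩ := Finset.lt_sup_iff.1 hlt
        have := hget m i
        rw [hs, List.getElem?_eq_getElem hm] at this
        simp at this
      rw [if_neg hlt, hs]

theorem langRegular_subset_tensorLang {β σ : Type} [Finite β] [Finite σ] {w a : ℕ}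
    (f : β → Layer σ w) (g : β → Layer (Fin a → Option σ) w) :
    LangRegular {x : List β | OddLang (x.map g) ⊆ tensorLang (OddLang (x.map f))} := by
  have hne : LangRegular {z : List (β × Option (Fin a → Option σ)) |
      ∀ v, some v ∈ z.map Prod.snd → ∃ m, v m ≠ none} := by
    have h := LangRegular.local_of_finite (β := β × Option (Fin a → Option σ)) (fun _ => True)
      fun c _ => ∀ v, c.2 = some v → ∃ m, v m ≠ none
    convert h using 4 with z
    simp only [true_and, List.mem_map]
    constructor
    · exact fun H i hi v hv => H v ⟨_, List.getElem_mem hi, hv⟩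
    · rintro H v ⟨c, hc, hv⟩
      obtain ⟨i, hi, rfl⟩ := List.mem_iff_getElem.1 hc
      exact H i hi v hv
  have h := ((langRegular_padAccepts (fun c : β × Option (Fin a → Option σ) => g c.1)
    Prod.snd).imp ((LangRegular.forall_finite fun m => langRegular_padAccepts
      (fun c : β × Option (Fin a → Option σ) => f c.1) fun c => c.2.bind (· m)).and
        hne)).forall_map Prod.fst
  convert h using 4 with x
  constructor
  · rintro H z rfl ⟨s, hs, hpad⟩
    have := hpad.mem_tensorLang_iff.1 (H (by simpa [OddLang, Function.comp_def] using hs))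
    simpa [Function.comp_def] using this
  · intro H s hs
    have hs' : OddAccepts (x.map g) s := hs
    have hpad : IsPadding (x.mapIdx fun i _ => s[i]?) s := by
      intro i
      rw [List.getElem?_mapIdx]
      by_cases hi : i < x.length
      · simp [hi]
      · have := hs'.2.1
        rw [List.length_map] at this
        rw [List.getElem?_eq_none (by omega), List.getElem?_eq_none (by omega)]
        rfl
    have hfst : (x.mapIdx fun i c => (c, s[i]?)).map Prod.fst = x := by
      apply List.ext_getElem <;> simp
    have hsnd : (x.mapIdx fun i c => (c, s[i]?)).map Prod.snd = x.mapIdx fun i _ => s[i]? := by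
      apply List.ext_getElem <;> simp
    have key := H _ hfst
    generalize (x.mapIdx fun i c => (c, s[i]?)) = z at *
    subst hfst
    rw [← hsnd] at hpad
    rw [hpad.mem_tensorLang_iff]
    have := key ⟨s, by simpa [Function.comp_def] using hs', hpad⟩
    simpa [Function.comp_def] using this

theorem getElem?_convStruct {σ : Type} {w r : ℕ} {ar : Fin r → ℕ} {p : ℕ}
    (q : StructTupleV σ w r ar p) (h : ∀ i, (q.1.2 i).length ≤ q.1.1.length)
    (h' : ∀ t, (q.2 t).length ≤ q.1.1.length) (j : ℕ) :
    (convStruct q)[j]? = if j < q.1.1.length then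
      some ((q.1.1[j]?, fun i => (q.1.2 i)[j]?), fun t => (q.2 t)[j]?) else none := by
  have hmax : max (max q.1.1.length (Finset.univ.sup fun i => (q.1.2 i).length))
      (Finset.univ.sup fun t => (q.2 t).length) = q.1.1.length := by
    rw [max_eq_left (Finset.sup_le fun i _ => h i), max_eq_left (Finset.sup_le fun t _ => h' t)]
  simp only [convStruct, List.getElem?_ofFn, hmax]
  rfl

theorem regularStruct_isStructural {σ : Type} [Finite σ] (w r : ℕ) (ar : Fin r → ℕ) (p : ℕ) :
    RegularStruct { q : StructTupleV σ w r ar p |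
        IsStructural q.1.1 q.1.2 ∧ ∀ t, q.2 t ∈ OddLang q.1.1 } := by
  let β := (Option (Layer σ w) × ((i : Fin r) → Option (Layer (Fin (ar i) → Option σ) w))) ×
    (Fin p → Option σ)
  let f (c : β) : Layer σ w := c.1.1.getD default
  let g (i : Fin r) (c : β) : Layer (Fin (ar i) → Option σ) w := (c.1.2 i).getD default
  have hβ : LangRegular {x : List β | ∀ i, (h : i < x.length) →
      x[i].1.1 ≠ none ∧ ∀ t, x[i].1.2 t ≠ none} := by
    simpa using LangRegular.local_of_finite (β := β) (fun _ => True)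
      fun c _ => c.1.1 ≠ none ∧ ∀ t, c.1.2 t ≠ none
  have h := (hβ.and ((langRegular_isODD f).and (LangRegular.forall_finite fun i =>
    (langRegular_isODD (g i)).and (langRegular_subset_tensorLang f (g i))))).and
      (LangRegular.forall_finite fun t => langRegular_padAccepts f fun c => c.2 t)
  unfold RegularStruct
  convert h using 4 with x
  constructor
  · rintro ⟨q, ⟨⟨hD, hDs⟩, hv⟩, rfl⟩
    have hget := getElem?_convStruct q (fun i => (hDs i).2.1.le) fun t => (hv t).2.1
    generalize convStruct q = x at hget
    have hlen : x.length = q.1.1.length := by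
      apply le_antisymm
      · simpa using hget q.1.1.length
      · by_contra hlt
        have := hget x.length
        rw [if_pos (by omega)] at this
        simp at this
    have hf : x.map f = q.1.1 := by
      refine List.ext_getElem? fun j => ?_
      rw [List.getElem?_map, hget]
      split_ifs with hj
      · simp [f, hj]
      · simp [not_lt.1 hj]
    have hg (i : Fin r) : x.map (g i) = q.1.2 i := by
      have hl := (hDs i).2.1
      refine List.ext_getElem? fun j => ?_
      rw [List.getElem?_map, hget]
      split_ifs with hj
      · simp [g, hl, hj]
      · simp [hl, not_lt.1 hj]
    simp only [hf, hg]
    refine ⟨⟨fun j hj => ?_, hD, fun i => ⟨(hDs i).1, (hDs i).2.2⟩⟩,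
      fun t => ⟨q.2 t, hv t, fun j => ?_⟩⟩
    · have := hget j
      rw [List.getElem?_eq_getElem hj, if_pos (by omega)] at this
      rw [Option.some.inj this]
      refine ⟨by simp; omega, fun i => ?_⟩
      have hl := (hDs i).2.1
      simp
      omega
    · rw [List.getElem?_map, hget]
      split_ifs with hj
      · simp
      · have := (hv t).2.1
        simp
        omega
  · rintro ⟨⟨hsome, hD, hDs⟩, hv⟩
    choose v hv hpad using hv
    have hlen (t : Fin p) : (v t).length ≤ x.length := by simpa using (hv t).2.1
    refine ⟨((x.map f, fun i => x.map (g i)), v),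
      ⟨⟨hD, fun i => ⟨(hDs i).1, by simp, (hDs i).2⟩⟩, hv⟩, List.ext_getElem? fun j => ?_⟩
    have hget : (convStruct ((x.map f, fun i => x.map (g i)), v))[j]? =
        if j < (x.map f).length then
          some (((x.map f)[j]?, fun i => (x.map (g i))[j]?), fun t => (v t)[j]?) else none :=
      getElem?_convStruct ((x.map f, fun i => x.map (g i)), v) (fun i => by simp)
        (fun t => (hlen t).trans_eq (List.length_map f).symm) j
    refine hget.trans ?_
    by_cases hj : j < x.length
    · obtain ⟨h1, h2⟩ := hsome j hj
      simp only [List.length_map, hj, if_true, List.getElem?_eq_getElem, Option.some.injEq]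
      refine Prod.ext (Prod.ext ?_ (funext fun i => ?_)) (funext fun t => ?_)
      · obtain ⟨l, hl⟩ := Option.ne_none_iff_exists'.1 h1
        simp [f, hl]
      · obtain ⟨l, hl⟩ := Option.ne_none_iff_exists'.1 (h2 i)
        simp [g, hl]
      · simpa [hj] using hpad t j
    · simp [hj]

theorem convStruct_elim0 {σ : Type} {w r : ℕ} {ar : Fin r → ℕ} (q : StructTuple σ w r ar)
    (v : Fin 0 → List σ) :
    convStruct (q, v) = (convTuple q).map fun c => (c, fun _ => none) := by
  refine List.ext_getElem? fun j => ?_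
  simp only [convStruct, convTuple, List.getElem?_map, List.getElem?_ofFn]
  simp only [Finset.univ_eq_empty, Finset.sup_empty, bot_eq_zero, Nat.max_zero]
  split_ifs
  · simp [funext_iff]
  · rfl

/-- The `(r+1+p)`-ary relation of all `(Σ,w,τ)`-structural tuples together with
`p` members of the domain language is regular; in particular (`p = 0`), the
relation of all `(Σ,w,τ)`-structural tuples is regular. -/
theorem stmt16 (σ : Type) [Fintype σ] [Nonempty σ] (w : ℕ) (hw : 0 < w)
    (r : ℕ) (ar : Fin r → ℕ) (har : ∀ i, 0 < ar i) (p : ℕ) :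
    RegularStruct { q : StructTupleV σ w r ar p |
        IsStructural q.1.1 q.1.2 ∧ ∀ t, q.2 t ∈ OddLang q.1.1 } ∧
    RegularTuple { q : StructTuple σ w r ar | IsStructural q.1 q.2 } := by
  refine ⟨regularStruct_isStructural w r ar p, ?_⟩
  have h := (regularStruct_isStructural (σ := σ) w r ar 0).comap
    fun c => (c, fun _ : Fin 0 => (none : Option σ))
  unfold RegularTuple
  convert h using 4 with x
  constructor
  · rintro ⟨q, hq, rfl⟩
    exact ⟨(q, fun _ => []), ⟨hq, fun t => t.elim0⟩, convStruct_elim0 q _⟩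
  · rintro ⟨⟨q, v⟩, ⟨hq, -⟩, hx⟩
    refine ⟨q, hq, ?_⟩
    rw [convStruct_elim0] at hx
    exact (List.map_injective_iff.2 fun a b hab => congrArg Prod.fst hab) hx
end

section
/- Let Σ be an alphabet, w ∈ ℕ⁺, and τ = (R₁,…,Rᵣ) a relational vocabulary with arities a₁,…,aᵣ. For every first-order sentence φ over τ, the (r+1)-ary relation D(Σ,w,τ,φ) = {T ∈ D(Σ,w,τ) : S(T) ⊨ φ}, consisting of all (Σ,w,τ)-structural tuples whose derived structure satisfies φ, is regular. -/
open FirstOrder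

/-- A predicate on words of arbitrary length, given as functions on `Fin k`, is regular if the
language of the words satisfying it is. -/
def RegPred {A : Type} (P : ∀ k : ℕ, (Fin k → A) → Prop) : Prop :=
  LangRegular { x : List A | P x.length x.get }

theorem pred_get_ofFn {A : Type} (P : ∀ k : ℕ, (Fin k → A) → Prop) {k : ℕ} (a : Fin k → A) :
    P (List.ofFn a).length (List.ofFn a).get ↔ P k a := by
  have h : (⟨_, (List.ofFn a).get⟩ : Σ n, Fin n → A) = ⟨k, a⟩ :=
    List.ofFn_inj'.1 (by simp)
  exact iff_of_eq (congrArg (fun s : Σ n, Fin n → A => P s.1 s.2) h)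

theorem regPred_of_dfa {A S : Type} [Finite S] {P : ∀ k : ℕ, (Fin k → A) → Prop} (M : DFA A S)
    (h : ∀ k (a : Fin k → A), List.ofFn a ∈ M.accepts ↔ P k a) : RegPred P := by
  have := Fintype.ofFinite S
  refine ⟨S, inferInstance, M, ?_⟩
  ext x
  have := h _ x.get
  rwa [List.ofFn_get] at this

theorem RegPred.exists_dfa {A : Type} {P : ∀ k : ℕ, (Fin k → A) → Prop} (h : RegPred P) :
    ∃ (S : Type) (_ : Finite S) (M : DFA A S),
      ∀ k (a : Fin k → A), List.ofFn a ∈ M.accepts ↔ P k a := by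
  obtain ⟨S, _, M, hM⟩ := h
  refine ⟨S, inferInstance, M, fun k a => ?_⟩
  rw [hM]
  exact pred_get_ofFn P a

theorem RegPred.congr {A : Type} {P Q : ∀ k : ℕ, (Fin k → A) → Prop} (h : RegPred P)
    (hPQ : ∀ k a, P k a ↔ Q k a) : RegPred Q := by
  have : P = Q := by
    ext k a
    exact hPQ k a
  exact this ▸ h

theorem RegPred.not {A : Type} {P : ∀ k : ℕ, (Fin k → A) → Prop} (h : RegPred P) :
    RegPred fun k a => ¬ P k a :=
  Language.IsRegular.compl h

theorem RegPred.and {A : Type} {P Q : ∀ k : ℕ, (Fin k → A) → Prop} (hP : RegPred P)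
    (hQ : RegPred Q) : RegPred fun k a => P k a ∧ Q k a :=
  Language.IsRegular.inf hP hQ

theorem RegPred.imp {A : Type} {P Q : ∀ k : ℕ, (Fin k → A) → Prop} (hP : RegPred P)
    (hQ : RegPred Q) : RegPred fun k a => P k a → Q k a :=
  (hP.and hQ.not).not.congr fun _ _ => by tauto

theorem RegPred.const {A : Type} (p : Prop) : RegPred fun k (_ : Fin k → A) => p := by
  refine regPred_of_dfa (⟨fun _ _ => (), (), { _u | p }⟩ : DFA A Unit) fun k a => ?_
  simp [DFA.mem_accepts]

theorem RegPred.forall_finite {A ι : Type} [Finite ι] {P : ι → ∀ k : ℕ, (Fin k → A) → Prop}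
    (h : ∀ i, RegPred (P i)) : RegPred fun k a => ∀ i, P i k a := by
  classical
  have := Fintype.ofFinite ι
  have key : ∀ s : Finset ι, RegPred fun k a => ∀ i ∈ s, P i k a := by
    intro s
    induction s using Finset.induction_on with
    | empty => exact (RegPred.const True).congr fun _ _ => by simp
    | insert i s _ ih => exact ((h i).and ih).congr fun _ _ => by simp
  exact (key Finset.univ).congr fun _ _ => by simp

theorem RegPred.comap {A B : Type} {P : ∀ k : ℕ, (Fin k → B) → Prop} (h : RegPred P)
    (f : A → B) : RegPred fun k a => P k fun i => f (a i) := by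
  obtain ⟨S, _, M, hM⟩ := h.exists_dfa
  refine regPred_of_dfa (M.comap f) fun k a => ?_
  rw [← hM, DFA.mem_accepts, DFA.eval_comap, List.map_ofFn]
  rfl

theorem RegPred.exists_track {A B : Type} {P : ∀ k : ℕ, (Fin k → A × B) → Prop}
    (h : RegPred P) : RegPred fun k a => ∃ b : Fin k → B, P k fun i => (a i, b i) := by
  obtain ⟨S, _, M, hM⟩ := h.exists_dfa
  let N : NFA A S := ⟨fun s a => { t | ∃ b, M.step s (a, b) = t }, {M.start}, M.accept⟩
  have key : ∀ (k : ℕ) (a : Fin k → A) (T : Set S) (t : S), t ∈ N.evalFrom T (List.ofFn a) ↔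
      ∃ s ∈ T, ∃ b : Fin k → B, M.evalFrom s (List.ofFn fun i => (a i, b i)) = t := by
    intro k
    induction k with
    | zero => intro a T t; simp
    | succ k ih =>
      intro a T t
      rw [List.ofFn_succ, NFA.evalFrom_cons, ih]
      simp only [NFA.mem_stepSet, List.ofFn_succ, DFA.evalFrom_cons, Fin.exists_fin_succ_pi,
        Fin.cons_zero, Fin.cons_succ]
      constructor
      · rintro ⟨_, ⟨s, hs, b₀, rfl⟩, b, hb⟩
        exact ⟨s, hs, b₀, b, hb⟩
      · rintro ⟨s, hs, b₀, b, hb⟩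
        exact ⟨_, ⟨s, hs, b₀, rfl⟩, b, hb⟩
  refine regPred_of_dfa N.toDFA fun k a => ?_
  rw [NFA.toDFA_correct, NFA.mem_accepts]
  simp only [key, ← hM, DFA.mem_accepts]
  constructor
  · rintro ⟨_, ht, _, rfl, b, rfl⟩
    exact ⟨b, ht⟩
  · rintro ⟨b, hb⟩
    exact ⟨_, hb, _, rfl, b, rfl⟩

theorem regPred_forall_letter {A : Type} (p : A → Prop) :
    RegPred fun k (a : Fin k → A) => ∀ i, p (a i) := by
  let M : DFA A Prop := ⟨fun s a => s ∧ p a, True, { s | s }⟩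
  have key : ∀ x : List A, M.eval x ↔ ∀ c ∈ x, p c := by
    intro x
    induction x using List.reverseRecOn with
    | nil => simp [M]
    | append_singleton x c ih =>
      rw [DFA.eval_append_singleton]
      change (M.eval x ∧ p c) ↔ _
      rw [ih]
      simp [or_imp, forall_and]
  refine regPred_of_dfa M fun k a => ?_
  change M.eval _ ↔ _
  rw [key]
  simp [List.mem_ofFn]

/-- Locally testable conditions: on the first letter, the last letter, and consecutive letters. -/
theorem regPred_local {A : Type} [Finite A] (p q : A → Prop) (R : A → A → Prop) :
    RegPred fun k (a : Fin k → A) => (∃ h : 0 < k, p (a ⟨0, h⟩) ∧ q (a ⟨k - 1, by omega⟩)) ∧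
      ∀ (i : ℕ) (h : i + 1 < k), R (a ⟨i, by omega⟩) (a ⟨i + 1, h⟩) := by
  let M : DFA A (Option A × Prop) :=
    ⟨fun s a => (some a, s.2 ∧ match s.1 with | none => p a | some b => R b a), (none, True),
      { s | s.2 ∧ ∃ b, s.1 = some b ∧ q b }⟩
  have key : ∀ (k : ℕ) (a : Fin (k + 1) → A), (M.eval (List.ofFn a)).1 = some (a (Fin.last k)) ∧
      ((M.eval (List.ofFn a)).2 ↔ p (a 0) ∧
        ∀ (i : ℕ) (h : i + 1 < k + 1), R (a ⟨i, by omega⟩) (a ⟨i + 1, h⟩)) := by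
    intro k
    induction k with
    | zero => intro a; simp [M, DFA.eval, DFA.evalFrom]
    | succ k ih =>
      intro a
      obtain ⟨h1, h2⟩ := ih fun i => a i.castSucc
      rw [List.ofFn_succ', List.concat_eq_append, DFA.eval_append_singleton]
      refine ⟨rfl, ?_⟩
      simp only [M] at h1 h2 ⊢
      rw [h1, h2]
      simp only [and_assoc]
      refine and_congr Iff.rfl ⟨fun ⟨h3, h4⟩ i hi => ?_, fun h3 => ⟨fun i hi => ?_, ?_⟩⟩
      · rcases Nat.lt_succ_iff_lt_or_eq.1 hi with h | h
        · exact h3 i h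
        · obtain rfl : i = k := by omega
          exact h4
      · exact h3 i (by omega)
      · exact h3 k (by omega)
  refine regPred_of_dfa M fun k a => ?_
  cases k with
  | zero => simp [DFA.mem_accepts, M]
  | succ k =>
    obtain ⟨h1, h2⟩ := key k a
    rw [DFA.mem_accepts]
    change (M.eval (List.ofFn a)).2 ∧ (∃ b, (M.eval (List.ofFn a)).1 = some b ∧ q b) ↔ _
    rw [h1, h2]
    simp only [Option.some.injEq, exists_eq_left', Nat.zero_lt_succ, exists_true_left]
    simp only [Nat.add_sub_cancel]
    exact ⟨fun ⟨⟨h3, h4⟩, h5⟩ => ⟨⟨h3, h5⟩, h4⟩, fun ⟨⟨h3, h5⟩, h4⟩ => ⟨⟨h3, h4⟩, h5⟩⟩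

instance {σ : Type} [Finite σ] {w : ℕ} : Finite (Layer σ w) := by
  refine Finite.of_injective (fun L : Layer σ w =>
    (L.left, L.right, L.trans, L.initial, L.final, L.ini, L.fin)) fun L L' h => ?_
  cases L
  cases L'
  simpa using h

theorem isODD_ofFn {σ : Type} {w k : ℕ} (d : Fin k → Layer σ w) :
    IsODD (List.ofFn d) ↔
      (∃ h : 0 < k, (d ⟨0, h⟩).ini = true ∧ (d ⟨k - 1, by omega⟩).fin = true) ∧
        ∀ (i : ℕ) (h : i + 1 < k), (d ⟨i + 1, h⟩).left = (d ⟨i, by omega⟩).right ∧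
          (d ⟨i + 1, h⟩).ini = false ∧ (d ⟨i, by omega⟩).fin = false := by
  simp only [IsODD, List.getElem_ofFn, List.length_ofFn, ne_eq, List.ofFn_eq_nil_iff]
  constructor
  · rintro ⟨hk, h1, h2⟩
    refine ⟨⟨by omega, (h2 0 (by omega)).1.2 rfl, (h2 (k - 1) (by omega)).2.2 rfl⟩,
      fun i hi => ⟨h1 i hi, ?_, ?_⟩⟩
    · rw [Bool.eq_false_iff, ne_eq, (h2 (i + 1) hi).1]
      omega
    · rw [Bool.eq_false_iff, ne_eq, (h2 i (by omega)).2]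
      omega
  · rintro ⟨⟨hk, h1, h2⟩, h3⟩
    refine ⟨by omega, fun i hi => (h3 i hi).1, fun i hi => ⟨?_, ?_⟩⟩
    · rcases i with _ | i
      · simpa using h1
      · simpa using (h3 i hi).2.1
    · by_cases h : i + 1 < k
      · simp only [(h3 i h).2.2, Bool.false_eq_true, false_iff]
        omega
      · obtain rfl : i = k - 1 := by omega
        simpa using h2

theorem regPred_isODD {σ : Type} [Finite σ] (w : ℕ) :
    RegPred fun k (d : Fin k → Layer σ w) => IsODD (List.ofFn d) :=
  (regPred_local (fun l : Layer σ w => l.ini = true) (fun l => l.fin = true)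
    fun l l' => l'.left = l.right ∧ l'.ini = false ∧ l.fin = false).congr
    fun _ d => (isODD_ofFn d).symm

/-- The ODD with layers `d` accepts the string whose symbols, padded to the length of the ODD, are
listed by `c`. -/
def AcceptsTrack {σ : Type} {w k : ℕ} (d : Fin k → Layer σ w) (c : Fin k → Option σ) : Prop :=
  ∃ s, OddAccepts (List.ofFn d) s ∧ ∀ i : Fin k, c i = s[(i : ℕ)]?

theorem exists_string_of_track {σ : Type} {k : ℕ} (c : Fin k → Option σ)
    (h : ∀ (i : ℕ) (hi : i + 1 < k), c ⟨i, by omega⟩ = none → c ⟨i + 1, hi⟩ = none) :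
    ∃ s : List σ, s.length ≤ k ∧ ∀ i : Fin k, c i = s[(i : ℕ)]? := by
  induction k with
  | zero => exact ⟨[], by simp, fun i => i.elim0⟩
  | succ k ih =>
    rcases h0 : c 0 with _ | b
    · refine ⟨[], by simp, ?_⟩
      rintro ⟨i, hi⟩
      induction i with
      | zero => simpa using h0
      | succ i ihi => simpa using h i hi (by simpa using ihi (by omega))
    · obtain ⟨s, hs, hcs⟩ := ih (fun i => c i.succ) fun i hi => h (i + 1) (by omega)
      refine ⟨b :: s, by simpa using hs, fun i => ?_⟩
      induction i using Fin.cases with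
      | zero => simpa using h0
      | succ i => simpa using hcs i

theorem eq_of_padded_eq {σ : Type} {k : ℕ} {s t : List σ} (hs : s.length ≤ k) (ht : t.length ≤ k)
    (h : ∀ i : Fin k, s[(i : ℕ)]? = t[(i : ℕ)]?) : s = t := by
  refine List.ext_getElem? fun i => ?_
  by_cases hi : i < k
  · exact h ⟨i, hi⟩
  · rw [List.getElem?_eq_none (by omega), List.getElem?_eq_none (by omega)]

theorem OddAccepts.length_le {σ : Type} {w k : ℕ} {d : Fin k → Layer σ w} {s : List σ}
    (h : OddAccepts (List.ofFn d) s) : s.length ≤ k := by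
  simpa using h.2.1

theorem acceptsTrack_iff {σ : Type} {w k : ℕ} {d : Fin k → Layer σ w} {s : List σ}
    (hs : s.length ≤ k) :
    AcceptsTrack d (fun i => s[(i : ℕ)]?) ↔ OddAccepts (List.ofFn d) s := by
  constructor
  · rintro ⟨t, ht, h⟩
    rwa [eq_of_padded_eq hs ht.length_le h]
  · exact fun h => ⟨s, h, fun _ => rfl⟩

theorem acceptsTrack_iff_exists_run {σ : Type} {w k : ℕ} (d : Fin k → Layer σ w)
    (c : Fin k → Option σ) : AcceptsTrack d c ↔ ∃ b : Fin k → Fin w × Fin w,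
      ((∃ h : 0 < k, ((c ⟨0, h⟩).isSome ∧ (b ⟨0, h⟩).1 ∈ (d ⟨0, h⟩).initial) ∧
          (b ⟨k - 1, by omega⟩).2 ∈ (d ⟨k - 1, by omega⟩).final) ∧
        ∀ (i : ℕ) (h : i + 1 < k), (b ⟨i, by omega⟩).2 = (b ⟨i + 1, h⟩).1 ∧
          (c ⟨i, by omega⟩ = none → c ⟨i + 1, h⟩ = none)) ∧
      ∀ i, ((b i).1, c i, (b i).2) ∈ (d i).trans := by
  constructor
  · rintro ⟨s, ⟨hs, hsk, st, hst, hst'⟩, hc⟩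
    simp only [List.length_ofFn, List.getElem_ofFn] at hsk hst hst'
    have hpos := List.length_pos_iff.2 hs
    have hk : 0 < k := by omega
    refine ⟨fun i => (st i, st (i + 1)), ⟨⟨hk, ⟨?_, (hst' hk).1⟩, ?_⟩, fun i hi => ⟨rfl, ?_⟩⟩,
      fun i => ?_⟩
    · simpa [hc] using hpos
    · simpa only [Nat.sub_add_cancel hk] using (hst' hk).2
    · simp only [hc, List.getElem?_eq_none_iff]
      omega
    · rw [hc]
      exact hst i i.2
  · rintro ⟨b, ⟨⟨hk, ⟨h0, hi⟩, hf⟩, hR⟩, ht⟩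
    obtain ⟨s, hs, hcs⟩ := exists_string_of_track c fun i hi => (hR i hi).2
    let st : ℕ → Fin w := fun i => if h : i < k then (b ⟨i, h⟩).1 else (b ⟨k - 1, by omega⟩).2
    refine ⟨s, ⟨?_, by simpa using hs, st, ?_, ?_⟩, hcs⟩
    · rintro rfl
      simp [hcs] at h0
    · intro i hi
      simp only [List.length_ofFn] at hi
      have h1 : st i = (b ⟨i, hi⟩).1 := dif_pos hi
      have h2 : st (i + 1) = (b ⟨i, hi⟩).2 := by
        by_cases h : i + 1 < k
        · rw [(hR i h).1]
          exact dif_pos h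
        · obtain rfl : i = k - 1 := by omega
          exact dif_neg h
      rw [h1, h2, List.getElem_ofFn, ← hcs ⟨i, hi⟩]
      exact ht _
    · intro _
      simp only [List.length_ofFn, List.getElem_ofFn]
      have h1 : st 0 = (b ⟨0, hk⟩).1 := dif_pos hk
      have h2 : st k = (b ⟨k - 1, by omega⟩).2 := dif_neg (lt_irrefl k)
      rw [h1, h2]
      exact ⟨hi, hf⟩

theorem regPred_acceptsTrack {σ : Type} [Finite σ] (w : ℕ) :
    RegPred fun k (a : Fin k → Layer σ w × Option σ) =>
      AcceptsTrack (fun i => (a i).1) fun i => (a i).2 :=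
  ((regPred_local
    (fun x : (Layer σ w × Option σ) × (Fin w × Fin w) =>
      x.1.2.isSome ∧ x.2.1 ∈ x.1.1.initial)
    (fun x => x.2.2 ∈ x.1.1.final)
    fun x y => x.2.2 = y.2.1 ∧ (x.1.2 = none → y.1.2 = none)).and
    (regPred_forall_letter fun x => (x.2.1, x.1.2, x.2.2) ∈ x.1.1.trans)).exists_track.congr
    fun _ a => (acceptsTrack_iff_exists_run (fun i => (a i).1) fun i => (a i).2).symm

open Classical in
/-- The letter of a padded convolution determined by the letters of its components. -/
noncomputable def convLetter {σ : Type} {a : ℕ} (f : Fin a → Option σ) :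
    Option (Fin a → Option σ) :=
  if ∀ m, f m = none then none else some f

theorem getElem?_convD_s18 {σ : Type} {a : ℕ} (us : Fin a → List σ) (j : ℕ) :
    (convD us)[j]? = convLetter fun m => (us m)[j]? := by
  rw [convD, convLetter, List.getElem?_ofFn]
  by_cases h : j < Finset.univ.sup fun i => (us i).length
  · rw [dif_pos h, if_neg]
    obtain ⟨m, -, hm⟩ := Finset.lt_sup_iff.1 h
    exact fun hall => by simpa [hm] using hall m
  · rw [dif_neg h, if_pos]
    intro m
    rw [List.getElem?_eq_none_iff]
    exact (Finset.le_sup (f := fun i => (us i).length) (Finset.mem_univ m)).trans (not_lt.1 h)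

theorem length_convD_le {σ : Type} {a k : ℕ} {us : Fin a → List σ}
    (h : ∀ m, (us m).length ≤ k) : (convD us).length ≤ k := by
  simpa [convD] using h

theorem oddLang_subset_tensorLang_iff {σ : Type} {w a k : ℕ} (d₀ : Fin k → Layer σ w)
    (d : Fin k → Layer (Fin a → Option σ) w) :
    OddLang (List.ofFn d) ⊆ tensorLang (OddLang (List.ofFn d₀)) ↔
      ¬ ∃ c : Fin k → Option (Fin a → Option σ), AcceptsTrack d c ∧
        ¬ ∃ f : Fin k → Fin a → Option σ, (∀ m, AcceptsTrack d₀ fun i => f i m) ∧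
          ∀ i, c i = convLetter (f i) := by
  constructor
  · rintro h ⟨c, ⟨s, hs, hc⟩, hn⟩
    obtain ⟨us, hus, rfl⟩ := h hs
    refine hn ⟨fun i m => (us m)[(i : ℕ)]?, fun m => ⟨us m, hus m, fun _ => rfl⟩, fun i => ?_⟩
    rw [hc, getElem?_convD_s18]
  · intro h s hs
    obtain ⟨f, hf, hfs⟩ := not_not.1 fun hn => h ⟨_, ⟨s, hs, fun _ => rfl⟩, hn⟩
    choose us hus hfus using hf
    refine ⟨us, hus, eq_of_padded_eq (k := k) ?_ (OddAccepts.length_le hs) fun i => ?_⟩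
    · exact length_convD_le fun m => (hus m).length_le
    · rw [getElem?_convD_s18, hfs]
      simp only [← hfus]

theorem regPred_oddLang_subset {σ : Type} [Finite σ] (w a : ℕ) :
    RegPred fun k (x : Fin k → Layer σ w × Layer (Fin a → Option σ) w) =>
      OddLang (List.ofFn fun i => (x i).2) ⊆
        tensorLang (OddLang (List.ofFn fun i => (x i).1)) := by
  have h1 : RegPred fun k (x : Fin k → ((Layer σ w × Layer (Fin a → Option σ) w) ×
      Option (Fin a → Option σ)) × (Fin a → Option σ)) =>
      (∀ m, AcceptsTrack (fun i => (x i).1.1.1) fun i => (x i).2 m) ∧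
        ∀ i, (x i).1.2 = convLetter (x i).2 :=
    (RegPred.forall_finite fun m =>
      (regPred_acceptsTrack w).comap fun l : ((Layer σ w × Layer (Fin a → Option σ) w) ×
        Option (Fin a → Option σ)) × (Fin a → Option σ) => (l.1.1.1, l.2 m)).and
      (regPred_forall_letter fun l : ((Layer σ w × Layer (Fin a → Option σ) w) ×
        Option (Fin a → Option σ)) × (Fin a → Option σ) => l.1.2 = convLetter l.2)
  have h2 := ((regPred_acceptsTrack w).comap fun l : (Layer σ w × Layer (Fin a → Option σ) w) ×
    Option (Fin a → Option σ) => (l.1.2, l.2)).and h1.exists_track.not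
  exact h2.exists_track.not.congr fun _ x =>
    (oddLang_subset_tensorLang_iff (fun i => (x i).1) fun i => (x i).2).symm

/-- A letter of the convolution of a structural tuple. -/
abbrev TupleLetter (σ : Type) (w r : ℕ) (ar : Fin r → ℕ) : Type :=
  Layer σ w × ((j : Fin r) → Layer (Fin (ar j) → Option σ) w)

/-- The tuple of strings of layers described by a word of tuple letters. -/
def tupleOf {σ : Type} {w r k : ℕ} {ar : Fin r → ℕ} (x : Fin k → TupleLetter σ w r ar) :
    StructTuple σ w r ar :=
  (List.ofFn fun i => (x i).1, fun j => List.ofFn fun i => (x i).2 j)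

theorem regPred_isStructural {σ : Type} [Finite σ] (w r : ℕ) (ar : Fin r → ℕ) :
    RegPred fun k (x : Fin k → TupleLetter σ w r ar) =>
      IsStructural (tupleOf x).1 (tupleOf x).2 := by
  refine (((regPred_isODD w).comap Prod.fst).and (RegPred.forall_finite fun j =>
    ((regPred_isODD w).comap fun l : TupleLetter σ w r ar => l.2 j).and
      ((regPred_oddLang_subset w (ar j)).comap fun l => (l.1, l.2 j)))).congr fun k x => ?_
  simp [IsStructural, tupleOf]

theorem exists_regPred_realize {σ : Type} [Finite σ] {w r : ℕ} {ar : Fin r → ℕ} {n : ℕ}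
    (φ : (vocLang r ar).BoundedFormula Empty n) :
    ∃ P : ∀ k : ℕ, (Fin k → TupleLetter σ w r ar × (Fin n → Option σ)) → Prop, RegPred P ∧
      ∀ (k : ℕ) (x : Fin k → TupleLetter σ w r ar)
        (vs : Fin n → { s : List σ // s ∈ OddLang (tupleOf x).1 }),
        P k (fun i => (x i, fun m => (vs m).1[(i : ℕ)]?)) ↔
          (letI := derivedStr (tupleOf x).1 (tupleOf x).2
           φ.Realize default vs) := by
  have hvar : ∀ {n : ℕ} (t : (vocLang r ar).Term (Empty ⊕ Fin n)), ∃ m : Fin n,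
      t = FirstOrder.Language.Term.var (Sum.inr m) := by
    intro n t
    cases t with
    | var v =>
      rcases v with v | m
      · exact v.elim
      · exact ⟨m, rfl⟩
    | func f _ => exact f.elim
  induction φ with
  | falsum => exact ⟨_, RegPred.const False, fun k x vs => Iff.rfl⟩
  | equal t₁ t₂ =>
    obtain ⟨m₁, rfl⟩ := hvar t₁
    obtain ⟨m₂, rfl⟩ := hvar t₂
    refine ⟨_, regPred_forall_letter fun l => l.2 m₁ = l.2 m₂, fun k x vs => ?_⟩
    change _ ↔ vs m₁ = vs m₂
    refine ⟨fun h => Subtype.ext ?_, fun h i => congrArg (fun v => v.1[(i : ℕ)]?) h⟩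
    exact eq_of_padded_eq (OddAccepts.length_le (vs m₁).2) (OddAccepts.length_le (vs m₂).2) h
  | @rel n l R ts =>
    obtain ⟨j, rfl⟩ := R
    choose m hm using fun i => hvar (ts i)
    obtain rfl : ts = _ := funext hm
    refine ⟨_, (regPred_acceptsTrack w).comap fun l : TupleLetter σ w r ar × (Fin n → Option σ) =>
      (l.1.2 j, convLetter fun i => l.2 (m i)), fun k x vs => ?_⟩
    change _ ↔ convD (fun i => (vs (m i)).1) ∈ OddLang ((tupleOf x).2 j)
    simp only [← getElem?_convD_s18 fun i => (vs (m i)).1]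
    exact acceptsTrack_iff (length_convD_le fun i => OddAccepts.length_le (vs (m i)).2)
  | imp φ ψ ih₁ ih₂ =>
    obtain ⟨P, hP, hP'⟩ := ih₁
    obtain ⟨Q, hQ, hQ'⟩ := ih₂
    exact ⟨_, hP.imp hQ, fun k x vs => imp_congr (hP' k x vs) (hQ' k x vs)⟩
  | @all n φ ih =>
    obtain ⟨P, hP, hP'⟩ := ih
    have h := ((regPred_acceptsTrack w).comap
      fun l : (TupleLetter σ w r ar × (Fin n → Option σ)) × Option σ => (l.1.1.1, l.2)).and
      (hP.comap fun l : (TupleLetter σ w r ar × (Fin n → Option σ)) × Option σ =>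
        (l.1.1, (Fin.snoc l.1.2 l.2 : Fin (n + 1) → Option σ))).not
    refine ⟨_, h.exists_track.not, fun k x vs => ?_⟩
    have hsnoc : ∀ (u : { s : List σ // s ∈ OddLang (tupleOf x).1 }) (i : Fin k),
        (Fin.snoc (fun m => (vs m).1[(i : ℕ)]?) u.1[(i : ℕ)]? : Fin (n + 1) → Option σ) =
          fun m => ((Fin.snoc vs u : Fin (n + 1) → _) m).1[(i : ℕ)]? := by
      intro u i
      funext m
      induction m using Fin.lastCases <;> simp
    simp only [not_exists, not_and, not_not]
    change _ ↔ ∀ u, _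
    constructor
    · intro h u
      refine (hP' k x _).1 ?_
      simpa only [hsnoc] using h (fun i => u.1[(i : ℕ)]?) ⟨u.1, u.2, fun _ => rfl⟩
    · rintro h c ⟨s, hs, hc⟩
      have := (hP' k x _).2 (h ⟨s, hs⟩)
      simpa only [hc, hsnoc ⟨s, hs⟩] using this

theorem convTuple_eq_ofFn {σ : Type} {w r : ℕ} {ar : Fin r → ℕ} {q : StructTuple σ w r ar} {k : ℕ}
    (h₀ : q.1.length = k) (h : ∀ j, (q.2 j).length = k) :
    convTuple q = List.ofFn fun i : Fin k => (q.1[(i : ℕ)]?, fun j => (q.2 j)[(i : ℕ)]?) := by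
  have hk : max q.1.length (Finset.univ.sup fun j => (q.2 j).length) = k := by
    rw [h₀]
    exact max_eq_left (Finset.sup_le fun j _ => (h j).le)
  rw [convTuple, List.ofFn_congr hk]
  rfl

theorem convTuple_tupleOf {σ : Type} {w r k : ℕ} {ar : Fin r → ℕ}
    (x : Fin k → TupleLetter σ w r ar) :
    convTuple (tupleOf x) = List.ofFn fun i => (some (x i).1, fun j => some ((x i).2 j)) := by
  rw [convTuple_eq_ofFn (k := k) (by simp [tupleOf]) (by simp [tupleOf])]
  simp [tupleOf]

theorem exists_eq_tupleOf {σ : Type} {w r : ℕ} {ar : Fin r → ℕ} {q : StructTuple σ w r ar}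
    (h : IsStructural q.1 q.2) : ∃ (k : ℕ) (x : Fin k → TupleLetter σ w r ar), q = tupleOf x := by
  have hlen := fun j => (h.2 j).2.1
  refine ⟨q.1.length, fun i => (q.1[i], fun j => (q.2 j)[(i : ℕ)]'(by rw [hlen]; exact i.2)), ?_⟩
  refine Prod.ext ?_ (funext fun j => ?_)
  · simp [tupleOf]
  · refine List.ext_getElem ?_ fun i h1 h2 => ?_
    · simp [tupleOf, hlen]
    · simp [tupleOf]

theorem regularTuple_of_regPred {σ : Type} [Finite σ] {w r : ℕ} {ar : Fin r → ℕ}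
    {R : Set (StructTuple σ w r ar)} (hR : ∀ q ∈ R, IsStructural q.1 q.2)
    (h : RegPred fun k (x : Fin k → TupleLetter σ w r ar) => tupleOf x ∈ R) : RegularTuple R := by
  have h' := ((h.comap Prod.snd).and (regPred_forall_letter
    fun l : (Option (Layer σ w) × ((j : Fin r) → Option (Layer (Fin (ar j) → Option σ) w))) ×
      TupleLetter σ w r ar => l.1 = (some l.2.1, fun j => some (l.2.2 j)))).exists_track
  unfold RegPred at h'
  unfold RegularTuple
  convert h' using 1
  ext y
  constructor
  · rintro ⟨q, hq, rfl⟩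
    obtain ⟨k, x, rfl⟩ := exists_eq_tupleOf (hR q hq)
    rw [convTuple_tupleOf]
    exact (pred_get_ofFn (fun k y => ∃ x : Fin k → TupleLetter σ w r ar, tupleOf x ∈ R ∧
      ∀ i, y i = (some (x i).1, fun j => some ((x i).2 j))) _).2 ⟨x, hq, fun _ => rfl⟩
  · rintro ⟨x, hx, hxy⟩
    refine ⟨_, hx, ?_⟩
    rw [convTuple_tupleOf]
    exact (congrArg List.ofFn (funext fun i => (hxy i).symm)).trans (List.ofFn_get y)

/-- For every first-order sentence `φ` over `τ`, the `(r+1)`-ary relation of all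
`(Σ,w,τ)`-structural tuples whose derived structure satisfies `φ` is regular. -/
theorem stmt18 (σ : Type) [Fintype σ] [Nonempty σ] (w : ℕ) (hw : 0 < w)
    (r : ℕ) (ar : Fin r → ℕ) (har : ∀ i, 0 < ar i)
    (φ : (vocLang r ar).Sentence) :
    RegularTuple { q : StructTuple σ w r ar |
      IsStructural q.1 q.2 ∧
      (letI := derivedStr q.1 q.2
       FirstOrder.Language.Sentence.Realize { s : List σ // s ∈ OddLang q.1 } φ) } := by
  obtain ⟨P, hP, hP'⟩ := exists_regPred_realize (σ := σ) (w := w) φ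
  refine regularTuple_of_regPred (fun q hq => hq.1) (((regPred_isStructural w r ar).and
    (hP.comap fun l : TupleLetter σ w r ar => (l, Fin.elim0))).congr fun k x => ?_)
  refine and_congr Iff.rfl ?_
  have h := hP' k x default
  have h₀ : (fun i => (x i, fun m : Fin 0 => ((default : Fin 0 →
      { s : List σ // s ∈ OddLang (tupleOf x).1 }) m).1[(i : ℕ)]?)) =
      fun i => (x i, Fin.elim0) := funext fun i => Prod.ext rfl (Subsingleton.elim _ _)
  rwa [h₀] at h
end
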